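/- Let 0 < p, q, u, v ≤ ∞ with p ≠ q and p, q < ∞. Then there exist constants c, C > 0 depending only on p, q, u, v such that for all n ∈ ℕ and all k ∈ ℕ: c · e_k(id: ℓ_p^n → ℓ_q^n) ≤ e_k(id: ℓ_{p,u}^n → ℓ_{q,v}^n) ≤ C · e_k(id: ℓ_p^n → ℓ_q^n); that is, the entropy numbers of the identity between the Lorentz spaces ℓ_{p,u}^n and ℓ_{q,v}^n are equivalent, uniformly in k and n, to those of the identity between the Lebesgue spaces ℓ_p^n and ℓ_q^n. -/

import Mathlib

open scoped ENNReal Classical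
open MeasureTheory

/-- The non-increasing rearrangement of `x : ℝ^n`: for `1 ≤ i ≤ n`,
`rearr n x i` is the `i`-th largest of the absolute values of the entries of `x`,
defined via `x_i^* = inf {t ≥ 0 : #{j : |x j| > t} ≤ i - 1}`. -/
noncomputable def rearr (n : ℕ) (x : Fin n → ℝ) (i : ℕ) : ℝ :=
  sInf {t : ℝ | 0 ≤ t ∧ ((Finset.univ : Finset (Fin n)).filter (fun j => t < |x j|)).card ≤ i - 1}

/-- The Lorentz quasi-norm `‖x‖_{p,u}` on `ℝ^n` for `p, u ∈ (0,∞]`, with the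
convention `1/∞ = 0`:  `‖x‖_{p,u} = (∑_{i=1}^n i^{u/p-1} (x_i^*)^u)^{1/u}` for `u < ∞`
and `‖x‖_{p,∞} = max_{1 ≤ i ≤ n} i^{1/p} x_i^*`. -/
noncomputable def lorentzNorm (n : ℕ) (p u : ℝ≥0∞) (x : Fin n → ℝ) : ℝ :=
  if u = ⊤ then
    sSup {t : ℝ | ∃ i ∈ Finset.Icc 1 n, t = (i : ℝ) ^ (1 / p).toReal * rearr n x i}
  else
    (∑ i ∈ Finset.Icc 1 n, (i : ℝ) ^ ((u / p).toReal - 1) * rearr n x i ^ u.toReal) ^ (1 / u.toReal)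

/-- The `k`-th (dyadic) entropy number of the identity map from `(ℝ^n, NX)` to `(ℝ^n, NY)`:
`e_k = inf {ε > 0 : ∃ y_1, …, y_{2^{k-1}} with B_X ⊆ ⋃ (y_i + ε B_Y)}`. -/
noncomputable def entropyNumber (n : ℕ) (NX NY : (Fin n → ℝ) → ℝ) (k : ℕ) : ℝ :=
  sInf {ε : ℝ | 0 < ε ∧ ∃ T : Finset (Fin n → ℝ), T.card ≤ 2 ^ (k - 1) ∧
    ∀ x : Fin n → ℝ, NX x ≤ 1 → ∃ y ∈ T, NY (x - y) ≤ ε}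

/-- The operator norm of the identity map from `(ℝ^n, NX)` to `(ℝ^n, NY)`:
`‖id‖ = sup {NY x : NX x ≤ 1}`. -/
noncomputable def opNorm (n : ℕ) (NX NY : (Fin n → ℝ) → ℝ) : ℝ :=
  sSup {t : ℝ | ∃ x : Fin n → ℝ, NX x ≤ 1 ∧ t = NY x}

section PowerSums

lemma sub_rpow_one_sub_bounds {β t : ℝ} (hβ : 0 < β) (ht0 : 0 ≤ t) (ht1 : t ≤ 1) :
    min β 1 * t ≤ 1 - (1 - t) ^ β ∧ 1 - (1 - t) ^ β ≤ max β 1 * t := by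
  rcases le_total β 1 with h | h
  · rw [min_eq_left h, max_eq_right h]
    constructor
    · have := rpow_one_add_le_one_add_mul_self (s := -t) (by linarith) hβ.le h
      rw [← sub_eq_add_neg] at this
      linarith
    · have := Real.rpow_le_rpow_of_exponent_ge' (x := 1 - t) (by linarith) (by linarith) hβ.le h
      rw [Real.rpow_one] at this
      linarith
  · rw [min_eq_right h, max_eq_left h]
    constructor
    · have := Real.rpow_le_rpow_of_exponent_ge' (x := 1 - t) (by linarith) (by linarith)
        zero_le_one h
      rw [Real.rpow_one] at this
      linarith
    · have := one_add_mul_self_le_rpow_one_add (s := -t) (by linarith) h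
      rw [← sub_eq_add_neg] at this
      linarith

lemma rpow_succ_sub_rpow_bounds {β : ℝ} (hβ : 0 < β) (i : ℕ) :
    min β 1 * ((i + 1 : ℕ) : ℝ) ^ (β - 1) ≤ ((i + 1 : ℕ) : ℝ) ^ β - (i : ℝ) ^ β ∧
      ((i + 1 : ℕ) : ℝ) ^ β - (i : ℝ) ^ β ≤ max β 1 * ((i + 1 : ℕ) : ℝ) ^ (β - 1) := by
  have hi : (0 : ℝ) < ((i + 1 : ℕ) : ℝ) := by positivity
  have ht1 : 1 / ((i + 1 : ℕ) : ℝ) ≤ 1 := by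
    rw [div_le_one hi]; push_cast; linarith [(Nat.cast_nonneg i : (0 : ℝ) ≤ i)]
  have key := sub_rpow_one_sub_bounds hβ (by positivity : 0 ≤ 1 / ((i + 1 : ℕ) : ℝ)) ht1
  have e1 : (i : ℝ) ^ β = ((i + 1 : ℕ) : ℝ) ^ β * (1 - 1 / ((i + 1 : ℕ) : ℝ)) ^ β := by
    rw [← Real.mul_rpow hi.le (by linarith)]
    congr 1
    push_cast
    field_simp
    ring
  have e2 : ((i + 1 : ℕ) : ℝ) ^ (β - 1) = ((i + 1 : ℕ) : ℝ) ^ β * (1 / ((i + 1 : ℕ) : ℝ)) := by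
    rw [Real.rpow_sub_one hi.ne']; ring
  have hpos : 0 < ((i + 1 : ℕ) : ℝ) ^ β := by positivity
  rw [e1, e2]
  constructor <;> nlinarith [mul_le_mul_of_nonneg_left key.1 hpos.le,
    mul_le_mul_of_nonneg_left key.2 hpos.le]

lemma sum_rpow_sub_one_bounds {β : ℝ} (hβ : 0 < β) (m : ℕ) :
    min β 1 * ∑ i ∈ Finset.Icc 1 m, (i : ℝ) ^ (β - 1) ≤ (m : ℝ) ^ β ∧
      (m : ℝ) ^ β ≤ max β 1 * ∑ i ∈ Finset.Icc 1 m, (i : ℝ) ^ (β - 1) := by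
  induction m with
  | zero => simp [Real.zero_rpow hβ.ne']
  | succ m ih =>
    rw [Finset.sum_Icc_succ_top (by omega), mul_add, mul_add]
    have := rpow_succ_sub_rpow_bounds hβ m
    constructor <;> linarith [ih.1, ih.2, this.1, this.2]

lemma sum_Ioc_rpow_neg_sub_one_le {β : ℝ} (hβ : 0 < β) {m : ℕ} (hm : 1 ≤ m) (n : ℕ) :
    β * ∑ i ∈ Finset.Ioc m n, (i : ℝ) ^ (-β - 1) ≤ (m : ℝ) ^ (-β) := by
  rcases le_total n m with h | h
  · rw [Finset.Ioc_eq_empty_of_le h]; simp; positivity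
  have step : ∀ n : ℕ, m ≤ n →
      β * ∑ i ∈ Finset.Ioc m n, (i : ℝ) ^ (-β - 1) ≤ (m : ℝ) ^ (-β) - (n : ℝ) ^ (-β) := by
    intro n hn
    induction n, hn using Nat.le_induction with
    | base => simp
    | succ i hi ih =>
      rw [Finset.sum_Ioc_succ_top (by omega), mul_add]
      have hi0 : (0 : ℝ) < i := by exact_mod_cast (by omega : 0 < i)
      have hi1 : (0 : ℝ) < ((i + 1 : ℕ) : ℝ) := by positivity
      set t : ℝ := 1 / ((i + 1 : ℕ) : ℝ) with ht
      have ht1 : 0 < 1 - t := by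
        rw [ht, sub_pos, div_lt_one hi1]; push_cast; linarith
      have e1 : (i : ℝ) ^ (-β) = ((i + 1 : ℕ) : ℝ) ^ (-β) * (1 - t) ^ (-β) := by
        rw [← Real.mul_rpow hi1.le ht1.le]
        congr 1
        rw [ht]
        push_cast
        field_simp
        ring
      have e2 : ((i + 1 : ℕ) : ℝ) ^ (-β - 1) = ((i + 1 : ℕ) : ℝ) ^ (-β) * t := by
        rw [Real.rpow_sub_one hi1.ne']; ring
      have h3 : 1 + β * t ≤ (1 - t) ^ (-β) := by
        have h4 : Real.exp (-t) ^ (-β) ≤ (1 - t) ^ (-β) :=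
          Real.rpow_le_rpow_of_nonpos ht1 (Real.one_sub_le_exp_neg t) (by linarith)
        rw [← Real.exp_mul] at h4
        have := Real.add_one_le_exp (-t * -β)
        linarith
      have hpos : 0 < ((i + 1 : ℕ) : ℝ) ^ (-β) := by positivity
      have := mul_le_mul_of_nonneg_left h3 hpos.le
      rw [e2]
      rw [e1] at ih
      linarith
  have := step n h
  have h2 : 0 ≤ (n : ℝ) ^ (-β) := by positivity
  linarith

end PowerSums

section Rearrangement

variable {n : ℕ} {x : Fin n → ℝ}

lemma rearr_nonneg (i : ℕ) : 0 ≤ rearr n x i :=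
  Real.sInf_nonneg fun _ ht => ht.1

lemma rearr_le {i : ℕ} {t : ℝ} (ht : 0 ≤ t)
    (h : ((Finset.univ : Finset (Fin n)).filter (fun j => t < |x j|)).card ≤ i - 1) :
    rearr n x i ≤ t :=
  csInf_le ⟨0, fun _ hs => hs.1⟩ ⟨ht, h⟩

lemma le_rearr {i : ℕ} (hi : 1 ≤ i) {t : ℝ}
    (h : i ≤ ((Finset.univ : Finset (Fin n)).filter (fun j => t ≤ |x j|)).card) :
    t ≤ rearr n x i := by
  apply le_csInf
  · refine ⟨∑ j, |x j|, by positivity, ?_⟩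
    rw [Finset.filter_false_of_mem]
    · simp
    · intro j _
      rw [not_lt]
      exact Finset.single_le_sum (f := fun j => |x j|) (fun _ _ => abs_nonneg _)
        (Finset.mem_univ j)
  · rintro s ⟨-, hs⟩
    by_contra! hst
    have : ((Finset.univ : Finset (Fin n)).filter (fun j => t ≤ |x j|)).card ≤
        ((Finset.univ : Finset (Fin n)).filter (fun j => s < |x j|)).card :=
      Finset.card_le_card (Finset.monotone_filter_right _ fun j _ hj => hst.trans_le hj)
    omega

end Rearrangement

section LorentzBounds

/-- A rearrangement dominated by `a * min ((m / i) ^ σ) ((m / i) ^ τ)` with `σ < 1 / q < τ`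
has Lorentz quasi-norm of order `a * m ^ (1 / q)`. -/
lemma exists_lorentzNorm_le {q v : ℝ≥0∞} (hq : 0 < q) (hq' : q ≠ ⊤) (hv : 0 < v) {σ τ : ℝ}
    (hσ : σ < 1 / q.toReal) (hτ : 1 / q.toReal < τ) :
    ∃ C : ℝ, 0 < C ∧ ∀ (n m : ℕ) (x : Fin n → ℝ) (a : ℝ), 1 ≤ m → 0 ≤ a →
      (∀ i, 1 ≤ i → i ≤ n → i ≤ m → rearr n x i ≤ a * ((m : ℝ) / i) ^ σ) →
      (∀ i, 1 ≤ i → i ≤ n → m < i → rearr n x i ≤ a * ((m : ℝ) / i) ^ τ) →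
      lorentzNorm n q v x ≤ C * (a * (m : ℝ) ^ (1 / q.toReal)) := by
  have hQ : 0 < q.toReal := ENNReal.toReal_pos hq.ne' hq'
  set Q := q.toReal with hQdef
  by_cases hvt : v = ⊤
  · refine ⟨1, one_pos, fun n m x a hm ha h1 h2 => ?_⟩
    have hm0 : (0 : ℝ) < m := by exact_mod_cast hm
    rw [lorentzNorm, if_pos hvt, one_mul]
    refine Real.sSup_le ?_ (by positivity)
    rintro t ⟨i, hi, rfl⟩
    rw [Finset.mem_Icc] at hi
    have hi0 : (0 : ℝ) < i := by exact_mod_cast hi.1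
    rw [ENNReal.toReal_div, ENNReal.toReal_one, ← hQdef]
    have bound : ∀ r : ℝ, ((m : ℝ) / i) ^ r ≤ ((m : ℝ) / i) ^ (1 / Q) →
        rearr n x i ≤ a * ((m : ℝ) / i) ^ r →
        (i : ℝ) ^ (1 / Q) * rearr n x i ≤ a * (m : ℝ) ^ (1 / Q) := by
      intro r hr hx
      calc (i : ℝ) ^ (1 / Q) * rearr n x i
          ≤ (i : ℝ) ^ (1 / Q) * (a * ((m : ℝ) / i) ^ (1 / Q)) := by
            gcongr
            exact hx.trans (by gcongr)
        _ = a * (m : ℝ) ^ (1 / Q) := by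
            rw [Real.div_rpow hm0.le hi0.le]
            field_simp
    rcases le_or_gt i m with him | him
    · refine bound σ (Real.rpow_le_rpow_of_exponent_le ?_ hσ.le) (h1 i hi.1 hi.2 him)
      rw [one_le_div hi0]; exact_mod_cast him
    · refine bound τ (Real.rpow_le_rpow_of_exponent_ge (by positivity) ?_ hτ.le)
        (h2 i hi.1 hi.2 him)
      rw [div_le_one hi0]; exact_mod_cast him.le
  · have hV : 0 < v.toReal := ENNReal.toReal_pos hv.ne' hvt
    set V := v.toReal with hVdef
    set β := (1 / Q - σ) * V with hβdef
    set γ := (τ - 1 / Q) * V with hγdef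
    have hβ : 0 < β := mul_pos (by linarith) hV
    have hγ : 0 < γ := mul_pos (by linarith) hV
    refine ⟨(1 / min β 1 + 1 / γ) ^ (1 / V), by positivity, fun n m x a hm ha h1 h2 => ?_⟩
    have hm0 : (0 : ℝ) < m := by exact_mod_cast hm
    rw [lorentzNorm, if_neg hvt, ENNReal.toReal_div, ← hQdef, ← hVdef]
    have term : ∀ r : ℝ, ∀ i : ℕ, 1 ≤ i → rearr n x i ≤ a * ((m : ℝ) / i) ^ r →
        (i : ℝ) ^ (V / Q - 1) * rearr n x i ^ V ≤
          a ^ V * (m : ℝ) ^ (r * V) * (i : ℝ) ^ ((1 / Q - r) * V - 1) := by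
      intro r i hi hx
      have hi0 : (0 : ℝ) < i := by exact_mod_cast hi
      calc (i : ℝ) ^ (V / Q - 1) * rearr n x i ^ V
          ≤ (i : ℝ) ^ (V / Q - 1) * (a * ((m : ℝ) / i) ^ r) ^ V := by
            have := rearr_nonneg (n := n) (x := x) i
            gcongr
        _ = a ^ V * (m : ℝ) ^ (r * V) * ((i : ℝ) ^ (V / Q - 1) / (i : ℝ) ^ (r * V)) := by
            rw [Real.mul_rpow ha (by positivity), Real.div_rpow hm0.le hi0.le,
              Real.div_rpow (by positivity) (by positivity), ← Real.rpow_mul hm0.le,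
              ← Real.rpow_mul hi0.le]
            ring
        _ = _ := by
            rw [← Real.rpow_sub hi0]
            congr 2
            ring
    have hsum : ∑ i ∈ Finset.Icc 1 n, (i : ℝ) ^ (V / Q - 1) * rearr n x i ^ V ≤
        (1 / min β 1 + 1 / γ) * (a * (m : ℝ) ^ (1 / Q)) ^ V := by
      have split : ∑ i ∈ Finset.Icc 1 n, (i : ℝ) ^ (V / Q - 1) * rearr n x i ^ V ≤
          ∑ i ∈ Finset.Icc 1 m, a ^ V * (m : ℝ) ^ (σ * V) * (i : ℝ) ^ (β - 1) +
          ∑ i ∈ Finset.Ioc m n, a ^ V * (m : ℝ) ^ (τ * V) * (i : ℝ) ^ (-γ - 1) := by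
        rw [← Finset.sum_filter_add_sum_filter_not (Finset.Icc 1 n) (fun i => i ≤ m)]
        refine add_le_add ?_ ?_
        · refine (Finset.sum_le_sum fun i hi => ?_).trans
            (Finset.sum_le_sum_of_subset_of_nonneg ?_ fun i _ _ => by positivity)
          · simp only [Finset.mem_filter, Finset.mem_Icc] at hi
            exact term σ i hi.1.1 (h1 i hi.1.1 hi.1.2 hi.2)
          · intro i hi
            simp only [Finset.mem_filter, Finset.mem_Icc] at hi ⊢
            exact ⟨hi.1.1, hi.2⟩
        · refine (Finset.sum_le_sum fun i hi => ?_).trans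
            (Finset.sum_le_sum_of_subset_of_nonneg ?_ fun i _ _ => by positivity)
          · simp only [Finset.mem_filter, Finset.mem_Icc, not_le] at hi
            have := term τ i hi.1.1 (h2 i hi.1.1 hi.1.2 hi.2)
            rwa [show (1 / Q - τ) * V - 1 = -γ - 1 by rw [hγdef]; ring] at this
          · intro i hi
            simp only [Finset.mem_filter, Finset.mem_Icc, Finset.mem_Ioc, not_le] at hi ⊢
            exact ⟨hi.2, hi.1.2⟩
      rw [← Finset.mul_sum, ← Finset.mul_sum] at split
      have s1 := (sum_rpow_sub_one_bounds hβ m).1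
      have s2 := sum_Ioc_rpow_neg_sub_one_le hγ hm n
      rw [← le_div_iff₀' (by positivity)] at s1 s2
      refine split.trans ?_
      have e1 : (a * (m : ℝ) ^ (1 / Q)) ^ V = a ^ V * (m : ℝ) ^ (σ * V) * (m : ℝ) ^ β := by
        rw [Real.mul_rpow ha (by positivity), ← Real.rpow_mul hm0.le, mul_assoc,
          ← Real.rpow_add hm0]
        congr 2
        rw [hβdef]; ring
      have e2 : (a * (m : ℝ) ^ (1 / Q)) ^ V = a ^ V * (m : ℝ) ^ (τ * V) * (m : ℝ) ^ (-γ) := by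
        rw [Real.mul_rpow ha (by positivity), ← Real.rpow_mul hm0.le, mul_assoc,
          ← Real.rpow_add hm0]
        congr 2
        rw [hγdef]; ring
      rw [add_mul]
      refine add_le_add ?_ ?_
      · rw [e1]
        calc _ ≤ a ^ V * (m : ℝ) ^ (σ * V) * ((m : ℝ) ^ β / min β 1) := by gcongr
          _ = _ := by ring
      · rw [e2]
        calc _ ≤ a ^ V * (m : ℝ) ^ (τ * V) * ((m : ℝ) ^ (-γ) / γ) := by gcongr
          _ = _ := by ring
    calc _ ≤ ((1 / min β 1 + 1 / γ) * (a * (m : ℝ) ^ (1 / Q)) ^ V) ^ (1 / V) := by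
          refine Real.rpow_le_rpow (Finset.sum_nonneg fun i _ => ?_) hsum (by positivity)
          have := rearr_nonneg (n := n) (x := x) i
          positivity
      _ = _ := by
          rw [Real.mul_rpow (by positivity) (by positivity), ← Real.rpow_mul (by positivity),
            mul_one_div_cancel hV.ne', Real.rpow_one]

/-- Chebyshev-type bound: elements of a Lorentz ball satisfy a weak-type estimate. -/
lemma exists_card_filter_le_of_lorentzNorm_le {q v : ℝ≥0∞} (hq : 0 < q) (hq' : q ≠ ⊤)
    (hv : 0 < v) :
    ∃ K : ℝ, 0 < K ∧ ∀ (n : ℕ) (x : Fin n → ℝ) (ε t : ℝ), 0 ≤ ε → 0 < t →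
      lorentzNorm n q v x ≤ ε →
      (((Finset.univ : Finset (Fin n)).filter (fun j => t ≤ |x j|)).card : ℝ) ≤
        K * (ε / t) ^ q.toReal := by
  have hQ : 0 < q.toReal := ENNReal.toReal_pos hq.ne' hq'
  set Q := q.toReal with hQdef
  by_cases hvt : v = ⊤
  · refine ⟨1, one_pos, fun n x ε t hε ht hx => ?_⟩
    set N := ((Finset.univ : Finset (Fin n)).filter (fun j => t ≤ |x j|)).card with hN
    rcases Nat.eq_zero_or_pos N with h0 | h0
    · rw [h0]; simp; positivity
    have hNn : N ≤ n := (Finset.card_le_univ _).trans (by simp)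
    have h1 : t ≤ rearr n x N := le_rearr h0 hN.le
    rw [lorentzNorm, if_pos hvt] at hx
    have h2 : (N : ℝ) ^ (1 / Q) * rearr n x N ≤ ε := by
      have hfin : {s : ℝ | ∃ i ∈ Finset.Icc 1 n,
          s = (i : ℝ) ^ (1 / q).toReal * rearr n x i}.Finite := by
        refine Set.Finite.subset ((Finset.Icc 1 n).image fun i : ℕ =>
          (i : ℝ) ^ (1 / q).toReal * rearr n x i).finite_toSet ?_
        rintro s ⟨i, hi, rfl⟩
        exact Finset.mem_coe.2 (Finset.mem_image_of_mem _ hi)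
      refine (le_csSup hfin.bddAbove ⟨N, Finset.mem_Icc.2 ⟨h0, hNn⟩, ?_⟩).trans hx
      rw [ENNReal.toReal_div, ENNReal.toReal_one]
    have h3 : (N : ℝ) ^ (1 / Q) ≤ ε / t := by
      rw [le_div_iff₀ ht]
      exact (mul_le_mul_of_nonneg_left h1 (by positivity)).trans h2
    calc (N : ℝ) = ((N : ℝ) ^ (1 / Q)) ^ Q := by
          rw [← Real.rpow_mul (by positivity), one_div_mul_cancel hQ.ne', Real.rpow_one]
      _ ≤ (ε / t) ^ Q := by gcongr
      _ = _ := (one_mul _).symm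
  · have hV : 0 < v.toReal := ENNReal.toReal_pos hv.ne' hvt
    set V := v.toReal with hVdef
    have hVQ : 0 < V / Q := by positivity
    refine ⟨(max (V / Q) 1) ^ (Q / V), by positivity, fun n x ε t hε ht hx => ?_⟩
    set N := ((Finset.univ : Finset (Fin n)).filter (fun j => t ≤ |x j|)).card with hN
    have hNn : N ≤ n := (Finset.card_le_univ _).trans (by simp)
    rw [lorentzNorm, if_neg hvt, ENNReal.toReal_div, ← hQdef, ← hVdef] at hx
    have hnn : ∀ i : ℕ, 0 ≤ (i : ℝ) ^ (V / Q - 1) * rearr n x i ^ V := fun i => by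
      have := rearr_nonneg (n := n) (x := x) i
      positivity
    have hx' : ∑ i ∈ Finset.Icc 1 n, (i : ℝ) ^ (V / Q - 1) * rearr n x i ^ V ≤ ε ^ V := by
      calc _ = ((∑ i ∈ Finset.Icc 1 n, (i : ℝ) ^ (V / Q - 1) * rearr n x i ^ V) ^ (1 / V)) ^ V := by
            rw [← Real.rpow_mul (Finset.sum_nonneg fun i _ => hnn i),
              one_div_mul_cancel hV.ne', Real.rpow_one]
        _ ≤ ε ^ V := Real.rpow_le_rpow
            (Real.rpow_nonneg (Finset.sum_nonneg fun i _ => hnn i) _) hx hV.le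
    have h1 : (∑ i ∈ Finset.Icc 1 N, (i : ℝ) ^ (V / Q - 1)) * t ^ V ≤ ε ^ V := by
      rw [Finset.sum_mul]
      refine (Finset.sum_le_sum fun i hi => ?_).trans
        ((Finset.sum_le_sum_of_subset_of_nonneg (Finset.Icc_subset_Icc_right hNn)
          fun i _ _ => hnn i).trans hx')
      rw [Finset.mem_Icc] at hi
      have := le_rearr hi.1 (hi.2.trans hN.le)
      gcongr
    have h2 := (sum_rpow_sub_one_bounds hVQ N).2
    have h3 : (N : ℝ) ^ (V / Q) ≤ max (V / Q) 1 * (ε / t) ^ V := by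
      rw [Real.div_rpow hε ht.le, ← mul_div_assoc, le_div_iff₀ (by positivity)]
      calc (N : ℝ) ^ (V / Q) * t ^ V
          ≤ (max (V / Q) 1 * ∑ i ∈ Finset.Icc 1 N, (i : ℝ) ^ (V / Q - 1)) * t ^ V := by gcongr
        _ = max (V / Q) 1 * ((∑ i ∈ Finset.Icc 1 N, (i : ℝ) ^ (V / Q - 1)) * t ^ V) := by ring
        _ ≤ _ := by gcongr
    calc (N : ℝ) = ((N : ℝ) ^ (V / Q)) ^ (Q / V) := by
          rw [← Real.rpow_mul (by positivity), div_mul_div_cancel₀ hQ.ne', div_self hV.ne',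
            Real.rpow_one]
      _ ≤ (max (V / Q) 1 * (ε / t) ^ V) ^ (Q / V) := by gcongr
      _ = _ := by
          rw [Real.mul_rpow (by positivity) (by positivity), ← Real.rpow_mul (by positivity),
            mul_div_cancel₀ _ hV.ne']

end LorentzBounds

section Counting

lemma sum_int_weight_le (R b : ℕ) (hR : 1 ≤ R) {l : ℝ} (hl : 0 ≤ l) :
    ∑ k ∈ Finset.Icc (-(b : ℤ)) b, (if k.natAbs < R then (1 : ℝ) else l * ((R : ℝ) / k) ^ 2) ≤
      2 * R - 1 + 4 * l * R := by
  have hR0 : (0 : ℝ) < R := by exact_mod_cast hR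
  rw [Finset.sum_ite]
  refine add_le_add ?_ ?_
  · rw [Finset.sum_const, nsmul_eq_mul, mul_one]
    have hsub : (Finset.Icc (-(b : ℤ)) b).filter (fun k => k.natAbs < R) ⊆
        Finset.Ioo (-(R : ℤ)) R := by
      intro k hk
      simp only [Finset.mem_filter, Finset.mem_Icc, Finset.mem_Ioo] at hk ⊢
      omega
    have hc := Finset.card_le_card hsub
    rw [Int.card_Ioo] at hc
    have : (((Finset.Icc (-(b : ℤ)) b).filter (fun k => k.natAbs < R)).card : ℤ) ≤ 2 * R - 1 := by
      omega
    exact_mod_cast this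
  · have hpos : ∑ k ∈ Finset.Ioo (R - 1) (b + 1), l * ((R : ℝ) / ((k : ℤ) : ℝ)) ^ 2 ≤
        2 * l * R := by
      have h := sum_Ioo_inv_sq_le (α := ℝ) (R - 1) (b + 1)
      have hcast : (((R - 1 : ℕ) : ℝ) + 1) = R := by
        rw [Nat.cast_sub hR]; simp
      rw [hcast] at h
      calc _ = l * R ^ 2 * ∑ k ∈ Finset.Ioo (R - 1) (b + 1), ((k : ℝ) ^ 2)⁻¹ := by
            rw [Finset.mul_sum]
            refine Finset.sum_congr rfl fun k _ => ?_
            push_cast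
            rw [div_pow]; ring
        _ ≤ l * R ^ 2 * (2 / R) := by gcongr
        _ = _ := by field_simp
    set S := Finset.Ioo (R - 1) (b + 1) with hS
    have hsub : (Finset.Icc (-(b : ℤ)) b).filter (fun k => ¬ k.natAbs < R) ⊆
        S.image (fun k : ℕ => (k : ℤ)) ∪ S.image (fun k : ℕ => -(k : ℤ)) := by
      intro k hk
      simp only [hS, Finset.mem_filter, Finset.mem_Icc, Finset.mem_union, Finset.mem_image,
        Finset.mem_Ioo] at hk ⊢
      rcases le_total 0 k with h | h
      · exact Or.inl ⟨k.natAbs, by omega, by omega⟩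
      · exact Or.inr ⟨k.natAbs, by omega, by omega⟩
    have hnn : ∀ k : ℤ, 0 ≤ l * ((R : ℝ) / k) ^ 2 := fun k => by positivity
    have hunion := Finset.sum_union_inter (s₁ := S.image (fun k : ℕ => (k : ℤ)))
      (s₂ := S.image (fun k : ℕ => -(k : ℤ))) (f := fun k : ℤ => l * ((R : ℝ) / k) ^ 2)
    rw [Finset.sum_image (by intro a _ b _ h; simpa using h),
      Finset.sum_image (by intro a _ b _ h; simpa using h)] at hunion
    have hneg : ∑ k ∈ S, l * ((R : ℝ) / ((-(k : ℤ) : ℤ) : ℝ)) ^ 2 =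
        ∑ k ∈ S, l * ((R : ℝ) / ((k : ℤ) : ℝ)) ^ 2 :=
      Finset.sum_congr rfl fun k _ => by push_cast; rw [div_neg, neg_sq]
    rw [hneg] at hunion
    have := Finset.sum_nonneg (s := S.image (fun k : ℕ => (k : ℤ)) ∩
      S.image (fun k : ℕ => -(k : ℤ))) fun k _ => hnn k
    have := Finset.sum_le_sum_of_subset_of_nonneg hsub fun k _ _ => hnn k
    linarith

lemma int_weight_ge (R J : ℕ) (hR : 1 ≤ R) {l : ℝ} (hl : 0 ≤ l) (k : ℤ)
    (hk : k.natAbs < 2 ^ J * R) :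
    (if R ≤ k.natAbs then l else 1) *
        (1 / 4 : ℝ) ^ ((Finset.range J).filter (fun j => 2 ^ j * R ≤ k.natAbs)).card ≤
      if k.natAbs < R then (1 : ℝ) else l * ((R : ℝ) / k) ^ 2 := by
  have hR0 : (0 : ℝ) < R := by exact_mod_cast hR
  by_cases h : k.natAbs < R
  · rw [if_pos h, if_neg (not_le.2 h), one_mul]
    exact pow_le_one₀ (by norm_num) (by norm_num)
  · rw [if_neg h, if_pos (not_lt.1 h)]
    refine mul_le_mul_of_nonneg_left ?_ hl
    set c := ((Finset.range J).filter (fun j => 2 ^ j * R ≤ k.natAbs)).card with hc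
    have hle : k.natAbs ≤ 2 ^ c * R := by
      by_contra! hlt
      have hcJ : c < J := by
        by_contra! hJc
        have : 2 ^ J * R ≤ 2 ^ c * R :=
          Nat.mul_le_mul_right _ (Nat.pow_le_pow_right (by norm_num) hJc)
        omega
      have hsub : Finset.range (c + 1) ⊆
          (Finset.range J).filter (fun j => 2 ^ j * R ≤ k.natAbs) := by
        intro j hj
        rw [Finset.mem_range] at hj
        rw [Finset.mem_filter, Finset.mem_range]
        refine ⟨by omega, ?_⟩
        have : 2 ^ j * R ≤ 2 ^ c * R :=
          Nat.mul_le_mul_right _ (Nat.pow_le_pow_right (by norm_num) (by omega))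
        omega
      have := Finset.card_le_card hsub
      rw [Finset.card_range] at this
      omega
    have hk0 : (0 : ℝ) < (k.natAbs : ℝ) := by
      exact_mod_cast (by omega : 0 < k.natAbs)
    have hle' : (k.natAbs : ℝ) ≤ 2 ^ c * R := by exact_mod_cast hle
    have hsq : ((R : ℝ) / k) ^ 2 = ((R : ℝ) / k.natAbs) ^ 2 := by
      rw [div_pow, div_pow, Nat.cast_natAbs, Int.cast_abs, sq_abs]
    rw [hsq]
    calc (1 / 4 : ℝ) ^ c = (1 / 2 ^ c) ^ 2 := by
          rw [div_pow, div_pow, one_pow, one_pow, ← pow_mul, mul_comm c, pow_mul]; norm_num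
      _ ≤ ((R : ℝ) / k.natAbs) ^ 2 := by
          refine pow_le_pow_left₀ (by positivity) ?_ 2
          rw [div_le_div_iff₀ (by positivity) hk0]
          linarith

/-- Number of integer vectors satisfying a weak-type estimate beyond the threshold `R`. -/
lemma exists_card_weak_le {P : ℝ} (hP : 0 < P) :
    ∃ A : ℝ, 1 ≤ A ∧ ∀ (n M R : ℕ) (l : ℝ) (Z : Finset (Fin n → ℤ)), 1 ≤ R → 0 < l → l ≤ 1 →
      (∀ z ∈ Z, ∀ s : ℝ, 1 ≤ s →
        (((Finset.univ : Finset (Fin n)).filter (fun j => s * R ≤ |(z j : ℝ)|)).card : ℝ) ≤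
          M * s ^ (-P)) →
      (Z.card : ℝ) ≤ (A / l) ^ M * (2 * R - 1 + 4 * l * R) ^ n := by
  have h2P : (2 : ℝ) ^ (-P) < 1 := Real.rpow_lt_one_of_one_lt_of_neg (by norm_num) (by linarith)
  have h2P0 : 0 < (2 : ℝ) ^ (-P) := by positivity
  obtain ⟨D, hD⟩ := exists_nat_ge ((1 - (2 : ℝ) ^ (-P))⁻¹)
  refine ⟨4 ^ D, one_le_pow₀ (by norm_num), fun n M R l Z hR hl hl1 hZ => ?_⟩
  set b : ℕ := ∑ z ∈ Z, ∑ j, (z j).natAbs with hb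
  have hzb : ∀ z ∈ Z, ∀ j, (z j).natAbs ≤ b := fun z hz j =>
    (Finset.single_le_sum (f := fun j => (z j).natAbs) (fun _ _ => Nat.zero_le _)
      (Finset.mem_univ j)).trans
      (Finset.single_le_sum (f := fun z : Fin n → ℤ => ∑ j, (z j).natAbs)
        (fun _ _ => Nat.zero_le _) hz)
  set w : ℤ → ℝ := fun k => if k.natAbs < R then (1 : ℝ) else l * ((R : ℝ) / k) ^ 2 with hw
  have hw0 : ∀ k, 0 ≤ w k := fun k => by
    rw [hw]; dsimp only; split_ifs <;> positivity
  have hprod : ∀ z ∈ Z, (l / 4 ^ D) ^ M ≤ ∏ j, w (z j) := by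
    intro z hz
    have hcnt : ∀ i : ℕ, (((Finset.univ : Finset (Fin n)).filter
        (fun j => 2 ^ i * R ≤ (z j).natAbs)).card : ℝ) ≤ M * ((2 : ℝ) ^ (-P)) ^ i := by
      intro i
      have := hZ z hz (2 ^ i) (one_le_pow₀ (by norm_num))
      rw [← Real.rpow_natCast 2 i, ← Real.rpow_mul (by norm_num), mul_comm (i : ℝ),
        Real.rpow_mul (by norm_num), Real.rpow_natCast, Real.rpow_natCast] at this
      convert this using 6 with j
      rw [← Int.cast_abs, ← Nat.cast_natAbs]
      exact_mod_cast Iff.rfl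
    have h1 : ((Finset.univ : Finset (Fin n)).filter (fun j => R ≤ (z j).natAbs)).card ≤ M := by
      have := hcnt 0
      simp only [pow_zero, one_mul, mul_one] at this
      exact_mod_cast this
    have h2 : ∑ j, ((Finset.range b).filter (fun i => 2 ^ i * R ≤ (z j).natAbs)).card ≤
        M * D := by
      simp only [Finset.card_filter]
      rw [Finset.sum_comm]
      simp only [← Finset.card_filter]
      have : ((∑ i ∈ Finset.range b, ((Finset.univ : Finset (Fin n)).filter
          (fun j => 2 ^ i * R ≤ (z j).natAbs)).card : ℕ) : ℝ) ≤ ((M * D : ℕ) : ℝ) := by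
        push_cast
        calc _ ≤ ∑ i ∈ Finset.range b, M * ((2 : ℝ) ^ (-P)) ^ i :=
              Finset.sum_le_sum fun i _ => hcnt i
          _ = M * ∑ i ∈ Finset.range b, ((2 : ℝ) ^ (-P)) ^ i := by rw [Finset.mul_sum]
          _ ≤ M * (1 - (2 : ℝ) ^ (-P))⁻¹ := by
              gcongr
              rw [← tsum_geometric_of_lt_one h2P0.le h2P]
              exact (summable_geometric_of_lt_one h2P0.le h2P).sum_le_tsum _
                fun i _ => by positivity
          _ ≤ _ := by gcongr
      exact_mod_cast this
    calc (l / 4 ^ D) ^ M = l ^ M * (1 / 4) ^ (M * D) := by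
          rw [div_pow, one_div, inv_pow, ← pow_mul, mul_comm M D]; rfl
      _ ≤ l ^ ((Finset.univ : Finset (Fin n)).filter (fun j => R ≤ (z j).natAbs)).card *
          (1 / 4) ^ (∑ j, ((Finset.range b).filter (fun i => 2 ^ i * R ≤ (z j).natAbs)).card) := by
          refine mul_le_mul (pow_le_pow_of_le_one hl.le hl1 h1)
            (pow_le_pow_of_le_one (by norm_num) (by norm_num) h2) (by positivity) (by positivity)
      _ = ∏ j, ((if R ≤ (z j).natAbs then l else 1) * (1 / 4 : ℝ) ^
            ((Finset.range b).filter (fun i => 2 ^ i * R ≤ (z j).natAbs)).card) := by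
          rw [Finset.prod_mul_distrib, Finset.prod_pow_eq_pow_sum, ← Finset.prod_filter,
            Finset.prod_const]
      _ ≤ ∏ j, w (z j) := by
          refine Finset.prod_le_prod (fun j _ => ?_) fun j _ => ?_
          · split_ifs <;> positivity
          · refine int_weight_ge R b hR hl.le (z j) ((hzb z hz j).trans_lt ?_)
            calc b < 2 ^ b := Nat.lt_two_pow_self
              _ ≤ 2 ^ b * R := Nat.le_mul_of_pos_right _ hR
  have hsum : ∑ z ∈ Z, ∏ j, w (z j) ≤ (2 * R - 1 + 4 * l * R) ^ n := by
    calc ∑ z ∈ Z, ∏ j, w (z j)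
        ≤ ∑ z ∈ Fintype.piFinset (fun _ : Fin n => Finset.Icc (-(b : ℤ)) b), ∏ j, w (z j) := by
          refine Finset.sum_le_sum_of_subset_of_nonneg (fun z hz => ?_)
            fun z _ _ => Finset.prod_nonneg fun j _ => hw0 _
          rw [Fintype.mem_piFinset]
          intro j
          have := hzb z hz j
          rw [Finset.mem_Icc]
          omega
      _ = (∑ k ∈ Finset.Icc (-(b : ℤ)) b, w k) ^ n := by
          rw [← Finset.prod_univ_sum]; simp
      _ ≤ _ := pow_le_pow_left₀ (Finset.sum_nonneg fun k _ => hw0 k)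
          (sum_int_weight_le R b hR hl.le) n
  have hcard : (Z.card : ℝ) * (l / 4 ^ D) ^ M ≤ ∑ z ∈ Z, ∏ j, w (z j) := by
    rw [← nsmul_eq_mul]
    exact Finset.card_nsmul_le_sum _ _ _ hprod
  have hpos : 0 < (l / (4 : ℝ) ^ D) ^ M := by positivity
  calc (Z.card : ℝ) = (4 ^ D / l) ^ M * (Z.card * (l / 4 ^ D) ^ M) := by
        rw [← inv_div l, inv_pow]
        field_simp
    _ ≤ _ := by
        gcongr
        exact hcard.trans hsum

/-- The bounds on the number of integer vectors in weak-type balls used for both nets and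
packings. -/
def WeakCountBound (P A : ℝ) : Prop :=
  1 ≤ A ∧
  (∀ (n M : ℕ) (Z : Finset (Fin n → ℤ)), 1 ≤ M → M ≤ n →
    (∀ z ∈ Z, ∀ s : ℝ, 1 ≤ s →
      (((Finset.univ : Finset (Fin n)).filter (fun j => s ≤ |(z j : ℝ)|)).card : ℝ) ≤
        M * s ^ (-P)) →
    (Z.card : ℝ) ≤ (A * n / M) ^ M) ∧
  (∀ (n R : ℕ) (Z : Finset (Fin n → ℤ)), 1 ≤ R →
    (∀ z ∈ Z, ∀ s : ℝ, 1 ≤ s →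
      (((Finset.univ : Finset (Fin n)).filter (fun j => s * R ≤ |(z j : ℝ)|)).card : ℝ) ≤
        n * s ^ (-P)) →
    (Z.card : ℝ) ≤ (A * R) ^ n)

lemma WeakCountBound.mono {P A A' : ℝ} (h : WeakCountBound P A) (hA : A ≤ A') :
    WeakCountBound P A' := by
  have h0 : 0 ≤ A := zero_le_one.trans h.1
  refine ⟨h.1.trans hA, fun n M Z hM hMn hZ => (h.2.1 n M Z hM hMn hZ).trans ?_,
    fun n R Z hR hZ => (h.2.2 n R Z hR hZ).trans ?_⟩ <;> gcongr

lemma exists_weakCountBound {P : ℝ} (hP : 0 < P) : ∃ A, WeakCountBound P A := by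
  obtain ⟨A, hA, h⟩ := exists_card_weak_le hP
  have h5 : (5 : ℝ) ≤ Real.exp 4 := by
    have := Real.add_one_le_exp (4 : ℝ)
    linarith
  have h6 : (6 : ℝ) ≤ Real.exp 5 := by
    have := Real.add_one_le_exp (5 : ℝ)
    linarith
  have h45 : Real.exp 4 ≤ Real.exp 5 := Real.exp_le_exp.2 (by norm_num)
  refine ⟨A * Real.exp 5, by nlinarith, fun n M Z hM hMn hZ => ?_, fun n R Z hR hZ => ?_⟩
  · have hM0 : (0 : ℝ) < M := by exact_mod_cast hM
    have hn0 : (0 : ℝ) < n := by exact_mod_cast hM.trans hMn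
    have := h n M 1 (M / n) Z le_rfl (by positivity)
      (by rw [div_le_one hn0]; exact_mod_cast hMn) (by simpa using hZ)
    refine this.trans ?_
    have e1 : (2 * ((1 : ℕ) : ℝ) - 1 + 4 * ((M : ℝ) / n) * ((1 : ℕ) : ℝ)) ^ n ≤
        Real.exp 4 ^ M := by
      calc _ ≤ Real.exp (4 * (M / n)) ^ n := by
            refine pow_le_pow_left₀ ?_ ?_ n
            · push_cast; rw [show (2 : ℝ) * 1 - 1 = 1 by norm_num]; positivity
            · have := Real.add_one_le_exp (4 * ((M : ℝ) / n))
              push_cast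
              linarith
        _ = Real.exp 4 ^ M := by
            rw [← Real.exp_nat_mul, ← Real.exp_nat_mul]
            congr 1
            field_simp
    calc _ ≤ (A / (M / n)) ^ M * Real.exp 4 ^ M := by gcongr
      _ = (A * Real.exp 4 * n / M) ^ M := by
          rw [← mul_pow]
          congr 1
          field_simp
      _ ≤ _ := by gcongr
  · have := h n n R 1 Z hR one_pos le_rfl hZ
    refine this.trans ?_
    rw [div_one, ← mul_pow]
    have hR1 : (1 : ℝ) ≤ R := by exact_mod_cast hR
    refine pow_le_pow_left₀ ?_ ?_ n
    · exact mul_nonneg (by linarith) (by linarith)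
    · rw [mul_assoc A]
      refine mul_le_mul_of_nonneg_left ?_ (by linarith)
      nlinarith

end Counting

section UpperBounds

lemma entropyNumber_le {n k : ℕ} {NX NY : (Fin n → ℝ) → ℝ} {ε : ℝ} (hε : 0 < ε)
    (T : Finset (Fin n → ℝ)) (hT : T.card ≤ 2 ^ (k - 1))
    (h : ∀ x, NX x ≤ 1 → ∃ y ∈ T, NY (x - y) ≤ ε) : entropyNumber n NX NY k ≤ ε :=
  csInf_le ⟨0, fun _ hs => hs.1.le⟩ ⟨hε, T, hT, h⟩

lemma exists_int_near (y : ℝ) : ∃ k : ℤ, |(k : ℝ)| ≤ |y| ∧ |y - k| ≤ |y| ∧ |y - k| ≤ 1 := by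
  rcases le_total 0 y with h | h
  · have h1 := Int.floor_le y
    have h2 := Int.lt_floor_add_one y
    have h3 : (0 : ℝ) ≤ ⌊y⌋ := by exact_mod_cast Int.floor_nonneg.2 h
    refine ⟨⌊y⌋, ?_⟩
    rw [abs_of_nonneg h, abs_of_nonneg h3, abs_of_nonneg (by linarith)]
    exact ⟨h1, by linarith, by linarith⟩
  · have h1 := Int.le_ceil y
    have h2 := Int.ceil_lt_add_one y
    have h3 : (⌈y⌉ : ℝ) ≤ 0 := by exact_mod_cast Int.ceil_nonpos.2 h
    refine ⟨⌈y⌉, ?_⟩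
    rw [abs_of_nonpos h, abs_of_nonpos h3, abs_of_nonpos (by linarith)]
    exact ⟨by linarith, by linarith, by linarith⟩

/-- Rounding towards zero gives a net of a weak-type ball whose errors are small in the
sup-norm and stay in the weak-type ball. -/
lemma exists_net_of_card_le {P K : ℝ} (hP : 0 < P) (hK : 0 < K) {n M R N : ℕ} (hM : 1 ≤ M)
    (hR : 1 ≤ R)
    (hcount : ∀ Z : Finset (Fin n → ℤ), (∀ z ∈ Z, ∀ s : ℝ, 1 ≤ s →
      (((Finset.univ : Finset (Fin n)).filter (fun j => s * R ≤ |(z j : ℝ)|)).card : ℝ) ≤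
        M * s ^ (-P)) → Z.card ≤ N) :
    ∃ T : Finset (Fin n → ℝ), T.card ≤ N ∧ ∀ x : Fin n → ℝ,
      (∀ t : ℝ, 0 < t → (((Finset.univ : Finset (Fin n)).filter (fun j => t ≤ |x j|)).card : ℝ) ≤
        K * (1 / t) ^ P) →
      ∃ y ∈ T, ∀ j, |(x - y) j| ≤ |x j| ∧ |(x - y) j| ≤ (K / M) ^ (1 / P) / R := by
  have hM0 : (0 : ℝ) < M := by exact_mod_cast hM
  have hR0 : (0 : ℝ) < R := by exact_mod_cast hR
  set S : Set (Fin n → ℤ) := {z | ∀ s : ℝ, 1 ≤ s →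
      (((Finset.univ : Finset (Fin n)).filter (fun j => s * R ≤ |(z j : ℝ)|)).card : ℝ) ≤
        M * s ^ (-P)} with hS
  have hfin : S.Finite := by
    by_contra hinf
    obtain ⟨t, ht, htc⟩ := Set.Infinite.exists_subset_card_eq hinf (N + 1)
    have := hcount t fun z hz => ht hz
    omega
  set δ : ℝ := (K / M) ^ (1 / P) / R with hδ
  have hδ0 : 0 < δ := by positivity
  refine ⟨hfin.toFinset.image fun z j => δ * (z j : ℝ), Finset.card_image_le.trans
    (hcount _ fun z hz => hfin.mem_toFinset.1 hz), fun x hx => ?_⟩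
  choose z hz1 hz2 hz3 using fun j => exists_int_near (x j / δ)
  have hxd : ∀ j, |x j| = δ * |x j / δ| := fun j => by
    rw [abs_div, abs_of_pos hδ0]; field_simp
  have hdiff : ∀ j, |x j - δ * z j| = δ * |x j / δ - z j| := fun j => by
    rw [← abs_of_pos hδ0, ← abs_mul, abs_of_pos hδ0]
    congr 1
    field_simp
  refine ⟨fun j => δ * (z j : ℝ), Finset.mem_image_of_mem _ (hfin.mem_toFinset.2 ?_),
    fun j => ?_⟩
  · intro s hs
    have hs0 : 0 < s := by linarith
    have h1 := hx (δ * (s * R)) (by positivity)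
    have h2 : ((Finset.univ : Finset (Fin n)).filter (fun j => s * R ≤ |(z j : ℝ)|)).card ≤
        ((Finset.univ : Finset (Fin n)).filter (fun j => δ * (s * R) ≤ |x j|)).card := by
      refine Finset.card_le_card (Finset.monotone_filter_right _ fun j _ hj => ?_)
      rw [hxd j]
      exact mul_le_mul_of_nonneg_left (hj.trans (hz1 j)) hδ0.le
    have h3 : K * (1 / (δ * (s * R))) ^ P = M * s ^ (-P) := by
      have : δ * (s * R) = (K / M) ^ (1 / P) * s := by rw [hδ]; field_simp
      rw [this, one_div, Real.inv_rpow (by positivity), Real.mul_rpow (by positivity) hs0.le,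
        ← Real.rpow_mul (by positivity), one_div_mul_cancel hP.ne', Real.rpow_one,
        Real.rpow_neg hs0.le]
      field_simp
    rw [← h3]
    exact le_trans (by exact_mod_cast h2) h1
  · rw [Pi.sub_apply, hdiff j]
    constructor
    · rw [hxd j]
      exact mul_le_mul_of_nonneg_left (hz2 j) hδ0.le
    · calc _ ≤ δ * 1 := mul_le_mul_of_nonneg_left (hz3 j) hδ0.le
        _ = _ := mul_one _

lemma rearr_le_of_weak {P K : ℝ} (hP : 0 < P) (hK : 0 < K) {n : ℕ} {x e : Fin n → ℝ}
    (hx : ∀ t : ℝ, 0 < t →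
      (((Finset.univ : Finset (Fin n)).filter (fun j => t ≤ |x j|)).card : ℝ) ≤ K * (1 / t) ^ P)
    (he : ∀ j, |e j| ≤ |x j|) {i : ℕ} (hi : 1 ≤ i) :
    rearr n e i ≤ (2 * K / i) ^ (1 / P) := by
  have hi0 : (0 : ℝ) < i := by exact_mod_cast hi
  refine rearr_le (by positivity) ?_
  have h1 := hx ((2 * K / i) ^ (1 / P)) (by positivity)
  have h2 : ((Finset.univ : Finset (Fin n)).filter
      (fun j => (2 * K / i) ^ (1 / P) < |e j|)).card ≤
      ((Finset.univ : Finset (Fin n)).filter (fun j => (2 * K / i) ^ (1 / P) ≤ |x j|)).card :=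
    Finset.card_le_card (Finset.monotone_filter_right _ fun j _ hj => hj.le.trans (he j))
  have h3 : K * (1 / (2 * K / i) ^ (1 / P)) ^ P = i / 2 := by
    rw [one_div, Real.inv_rpow (by positivity), ← Real.rpow_mul (by positivity),
      one_div_mul_cancel hP.ne', Real.rpow_one]
    field_simp
  rw [h3] at h1
  have h4 : (((Finset.univ : Finset (Fin n)).filter
      (fun j => (2 * K / i) ^ (1 / P) < |e j|)).card : ℝ) ≤ i / 2 :=
    le_trans (by exact_mod_cast h2) h1
  have h5 : 2 * ((Finset.univ : Finset (Fin n)).filter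
      (fun j => (2 * K / i) ^ (1 / P) < |e j|)).card ≤ i := by
    rw [le_div_iff₀ (by norm_num)] at h4
    have : ((2 * ((Finset.univ : Finset (Fin n)).filter
      (fun j => (2 * K / i) ^ (1 / P) < |e j|)).card : ℕ) : ℝ) ≤ i := by
      push_cast; linarith
    exact_mod_cast this
  omega

lemma rearr_le_of_abs_le {n : ℕ} {x : Fin n → ℝ} {b : ℝ} (hb : 0 ≤ b) (h : ∀ j, |x j| ≤ b)
    (i : ℕ) : rearr n x i ≤ b := by
  refine rearr_le hb ?_
  rw [Finset.filter_false_of_mem fun j _ => not_lt.2 (h j)]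
  simp

variable {p q u v : ℝ≥0∞}

/-- A single centre at the origin works for every dimension if `p < q`. -/
lemma exists_entropyNumber_le_const (hp : 0 < p) (hq : 0 < q) (hu : 0 < u) (hv : 0 < v)
    (hp' : p ≠ ⊤) (hq' : q ≠ ⊤) (hpq : p.toReal < q.toReal) :
    ∃ C : ℝ, 0 < C ∧ ∀ n k : ℕ,
      entropyNumber n (lorentzNorm n p u) (lorentzNorm n q v) k ≤ C := by
  have hP : 0 < p.toReal := ENNReal.toReal_pos hp.ne' hp'
  have hQ : 0 < q.toReal := ENNReal.toReal_pos hq.ne' hq'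
  obtain ⟨K, hK, hcheb⟩ := exists_card_filter_le_of_lorentzNorm_le hp hp' hu
  obtain ⟨C, hC, hnorm⟩ := exists_lorentzNorm_le hq hq' hv (σ := 0) (τ := 1 / p.toReal)
    (by positivity) (one_div_lt_one_div_of_lt hP hpq)
  refine ⟨C * ((2 * K) ^ (1 / p.toReal) * ((1 : ℕ) : ℝ) ^ (1 / q.toReal)), by positivity,
    fun n k => ?_⟩
  refine entropyNumber_le (by positivity) {0} (by simpa using Nat.one_le_two_pow) fun x hx => ?_
  refine ⟨0, by simp, ?_⟩
  have hw := fun t ht => hcheb n x 1 t zero_le_one ht hx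
  have hr : ∀ i, 1 ≤ i → rearr n (x - 0) i ≤
      (2 * K) ^ (1 / p.toReal) * (((1 : ℕ) : ℝ) / i) ^ (1 / p.toReal) := fun i hi => by
    refine (rearr_le_of_weak hP hK hw (by simp) hi).trans_eq ?_
    rw [← Real.mul_rpow (by positivity) (by positivity)]
    congr 1
    push_cast; ring
  refine hnorm n 1 _ _ le_rfl (by positivity) (fun i hi _ hi1 => ?_) fun i hi _ _ => hr i hi
  obtain rfl : i = 1 := by omega
  simpa using hr 1 le_rfl

lemma exists_entropyNumber_le_rpow (hp : 0 < p) (hq : 0 < q) (hu : 0 < u) (hv : 0 < v)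
    (hp' : p ≠ ⊤) (hq' : q ≠ ⊤) (hpq : q.toReal < p.toReal) :
    ∃ C : ℝ, 0 < C ∧ ∀ n k : ℕ, 0 < n →
      entropyNumber n (lorentzNorm n p u) (lorentzNorm n q v) k ≤
        C * (n : ℝ) ^ (1 / q.toReal - 1 / p.toReal) := by
  have hP : 0 < p.toReal := ENNReal.toReal_pos hp.ne' hp'
  have hQ : 0 < q.toReal := ENNReal.toReal_pos hq.ne' hq'
  obtain ⟨K, hK, hcheb⟩ := exists_card_filter_le_of_lorentzNorm_le hp hp' hu
  obtain ⟨C, hC, hnorm⟩ := exists_lorentzNorm_le hq hq' hv (σ := 1 / p.toReal)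
    (one_div_lt_one_div_of_lt hQ hpq) (lt_add_one _)
  refine ⟨C * (2 * K) ^ (1 / p.toReal), by positivity, fun n k hn => ?_⟩
  have hn0 : (0 : ℝ) < n := by exact_mod_cast hn
  refine entropyNumber_le (by positivity) {0} (by simpa using Nat.one_le_two_pow) fun x hx => ?_
  refine ⟨0, by simp, ?_⟩
  have hw := fun t ht => hcheb n x 1 t zero_le_one ht hx
  refine (hnorm n n (x - 0) ((2 * K / n) ^ (1 / p.toReal)) hn (by positivity)
    (fun i hi _ _ => ?_) fun i _ hi hi' => by omega).trans_eq ?_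
  · have hi0 : (0 : ℝ) < i := by exact_mod_cast hi
    refine (rearr_le_of_weak hP hK hw (by simp) hi).trans_eq ?_
    rw [← Real.mul_rpow (by positivity) (by positivity)]
    congr 1
    field_simp
  · rw [Real.div_rpow (by positivity) hn0.le, Real.rpow_sub hn0]
    ring

/-- Sparse approximation: the bound in the range of intermediate `k` if `p < q`. -/
lemma exists_entropyNumber_le_sparse (hp : 0 < p) (hq : 0 < q) (hu : 0 < u) (hv : 0 < v)
    (hp' : p ≠ ⊤) (hq' : q ≠ ⊤) (hpq : p.toReal < q.toReal) {A : ℝ}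
    (hA : WeakCountBound p.toReal A) :
    ∃ C : ℝ, 0 < C ∧ ∀ n k m : ℕ, 1 ≤ m → m ≤ n → (A * n / m) ^ m ≤ (2 : ℝ) ^ (k - 1) →
      entropyNumber n (lorentzNorm n p u) (lorentzNorm n q v) k ≤
        C * (m : ℝ) ^ (1 / q.toReal - 1 / p.toReal) := by
  have hP : 0 < p.toReal := ENNReal.toReal_pos hp.ne' hp'
  have hQ : 0 < q.toReal := ENNReal.toReal_pos hq.ne' hq'
  obtain ⟨K, hK, hcheb⟩ := exists_card_filter_le_of_lorentzNorm_le hp hp' hu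
  obtain ⟨C, hC, hnorm⟩ := exists_lorentzNorm_le hq hq' hv (σ := 0) (τ := 1 / p.toReal)
    (by positivity) (one_div_lt_one_div_of_lt hP hpq)
  refine ⟨C * (2 * K) ^ (1 / p.toReal), by positivity, fun n k m hm hmn hk => ?_⟩
  have hm0 : (0 : ℝ) < m := by exact_mod_cast hm
  obtain ⟨T, hTc, hT⟩ := exists_net_of_card_le (n := n) (N := 2 ^ (k - 1)) hP hK hm le_rfl
    fun Z hZ => by
      have := (hA.2.1 n m Z hm hmn (by simpa using hZ)).trans hk
      exact_mod_cast this
  refine entropyNumber_le (by positivity) T hTc fun x hx => ?_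
  have hw := fun t ht => hcheb n x 1 t zero_le_one ht hx
  obtain ⟨y, hy, hxy⟩ := hT x hw
  refine ⟨y, hy, ?_⟩
  refine (hnorm n m (x - y) ((2 * K / m) ^ (1 / p.toReal)) hm (by positivity)
    (fun i hi _ _ => ?_) fun i hi _ _ => ?_).trans_eq ?_
  · rw [Real.rpow_zero, mul_one]
    refine rearr_le_of_abs_le (by positivity) (fun j => (hxy j).2.trans ?_) i
    rw [Nat.cast_one, div_one]
    refine Real.rpow_le_rpow (by positivity) ?_ (by positivity)
    gcongr
    linarith
  · have hi0 : (0 : ℝ) < i := by exact_mod_cast hi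
    refine (rearr_le_of_weak hP hK hw (fun j => (hxy j).1) hi).trans_eq ?_
    rw [← Real.mul_rpow (by positivity) (by positivity)]
    congr 1
    field_simp
  · rw [Real.div_rpow (by positivity) hm0.le, Real.rpow_sub hm0]
    ring

/-- Volumetric range: the upper bound for large `k`. -/
lemma exists_entropyNumber_le_volume (hp : 0 < p) (hq : 0 < q) (hu : 0 < u) (hv : 0 < v)
    (hp' : p ≠ ⊤) (hq' : q ≠ ⊤) {A : ℝ} (hA : WeakCountBound p.toReal A) :
    ∃ C : ℝ, 0 < C ∧ ∀ n k : ℕ, 0 < n → A ^ n ≤ (2 : ℝ) ^ (k - 1) →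
      entropyNumber n (lorentzNorm n p u) (lorentzNorm n q v) k ≤
        C * ((n : ℝ) ^ (1 / q.toReal - 1 / p.toReal) /
          ((2 : ℝ) ^ (k - 1)) ^ (1 / (n : ℝ))) := by
  have hP : 0 < p.toReal := ENNReal.toReal_pos hp.ne' hp'
  have hQ : 0 < q.toReal := ENNReal.toReal_pos hq.ne' hq'
  have hA0 : 0 < A := zero_lt_one.trans_le hA.1
  obtain ⟨K, hK, hcheb⟩ := exists_card_filter_le_of_lorentzNorm_le hp hp' hu
  obtain ⟨C, hC, hnorm⟩ := exists_lorentzNorm_le hq hq' hv (σ := 0) (by positivity)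
    (lt_add_one _)
  refine ⟨C * K ^ (1 / p.toReal) * (2 * A), by positivity, fun n k hn hk => ?_⟩
  have hn0 : (0 : ℝ) < n := by exact_mod_cast hn
  set y : ℝ := ((2 : ℝ) ^ (k - 1)) ^ (1 / (n : ℝ)) with hy
  have hy0 : 0 < y := by positivity
  have hyn : y ^ n = (2 : ℝ) ^ (k - 1) := by
    rw [hy, one_div, Real.rpow_inv_natCast_pow (by positivity) hn.ne']
  have hAy : A ≤ y := by
    rw [← hyn] at hk
    exact (pow_le_pow_iff_left₀ hA0.le hy0.le hn.ne').1 hk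
  have hyA : 1 ≤ y / A := (one_le_div hA0).2 hAy
  set R := ⌊y / A⌋₊ with hR
  have hR1 : 1 ≤ R := Nat.le_floor (by exact_mod_cast hyA)
  have hR0 : (1 : ℝ) ≤ R := by exact_mod_cast hR1
  have hRle : (R : ℝ) ≤ y / A := Nat.floor_le (by positivity)
  have hRge : y / A ≤ 2 * R := by
    have := Nat.lt_floor_add_one (y / A)
    linarith
  obtain ⟨T, hTc, hT⟩ := exists_net_of_card_le (n := n) (M := n) (N := 2 ^ (k - 1)) hP hK hn hR1
    fun Z hZ => by
      have h1 := hA.2.2 n R Z hR1 hZ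
      have h2 : (A * R) ^ n ≤ (2 : ℝ) ^ (k - 1) := by
        rw [← hyn]
        refine pow_le_pow_left₀ (by positivity) ?_ n
        rwa [le_div_iff₀' hA0] at hRle
      exact_mod_cast h1.trans h2
  refine entropyNumber_le (by positivity) T hTc fun x hx => ?_
  have hw := fun t ht => hcheb n x 1 t zero_le_one ht hx
  obtain ⟨z, hz, hxz⟩ := hT x hw
  refine ⟨z, hz, ?_⟩
  refine (hnorm n n (x - z) ((K / n) ^ (1 / p.toReal) / R) hn (by positivity)
    (fun i hi _ _ => ?_) fun i hi h1 h2 => by omega).trans ?_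
  · rw [Real.rpow_zero, mul_one]
    exact rearr_le_of_abs_le (by positivity) (fun j => (hxz j).2) i
  · rw [Real.div_rpow hK.le hn0.le, Real.rpow_sub hn0]
    have hinv : 1 / (R : ℝ) ≤ 2 * A / y := by
      rw [div_le_div_iff₀ (by positivity) hy0]
      rw [div_le_iff₀ hA0] at hRge
      linarith
    calc C * (K ^ (1 / p.toReal) / (n : ℝ) ^ (1 / p.toReal) / R * (n : ℝ) ^ (1 / q.toReal))
        = C * K ^ (1 / p.toReal) * ((n : ℝ) ^ (1 / q.toReal) / (n : ℝ) ^ (1 / p.toReal)) *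
          (1 / R) := by ring
      _ ≤ C * K ^ (1 / p.toReal) * ((n : ℝ) ^ (1 / q.toReal) / (n : ℝ) ^ (1 / p.toReal)) *
          (2 * A / y) := by gcongr
      _ = _ := by ring

end UpperBounds

section LowerBounds

variable {p q u v : ℝ≥0∞}

lemma le_entropyNumber (hp : 0 < p) (hq : 0 < q) (hu : 0 < u) (hv : 0 < v)
    (hp' : p ≠ ⊤) (hq' : q ≠ ⊤) {n k : ℕ} {c : ℝ}
    (h : ∀ ε : ℝ, 0 < ε → ∀ T : Finset (Fin n → ℝ), T.card ≤ 2 ^ (k - 1) →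
      (∀ x, lorentzNorm n p u x ≤ 1 → ∃ y ∈ T, lorentzNorm n q v (x - y) ≤ ε) → c ≤ ε) :
    c ≤ entropyNumber n (lorentzNorm n p u) (lorentzNorm n q v) k := by
  have hP : 0 < p.toReal := ENNReal.toReal_pos hp.ne' hp'
  have hQ : 0 < q.toReal := ENNReal.toReal_pos hq.ne' hq'
  obtain ⟨K, hK, hcheb⟩ := exists_card_filter_le_of_lorentzNorm_le hp hp' hu
  obtain ⟨C, hC, hnorm⟩ := exists_lorentzNorm_le hq hq' hv (σ := 0) (by positivity)
    (lt_add_one _)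
  refine le_csInf ⟨C * ((2 * K) ^ (1 / p.toReal) * ((n + 1 : ℕ) : ℝ) ^ (1 / q.toReal)),
    by positivity, {0}, by simpa using Nat.one_le_two_pow, fun x hx => ⟨0, by simp, ?_⟩⟩
    fun ε hε => ?_
  · have hw := fun t ht => hcheb n x 1 t zero_le_one ht hx
    refine hnorm n (n + 1) _ _ (by omega) (by positivity) (fun i hi _ _ => ?_)
      fun i _ _ _ => by omega
    refine (rearr_le_of_weak hP hK hw (by simp) hi).trans ?_
    rw [Real.rpow_zero, mul_one]
    have hi1 : (1 : ℝ) ≤ i := by exact_mod_cast hi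
    exact Real.rpow_le_rpow (by positivity) (div_le_self (by positivity) hi1) (by positivity)
  · obtain ⟨h0, T, hT, hcov⟩ := hε
    exact h ε h0 T hT hcov

/-- Sparse vectors with bounded entries have small Lorentz quasi-norm. -/
lemma exists_lorentzNorm_le_of_sparse (hp : 0 < p) (hp' : p ≠ ⊤) (hu : 0 < u) :
    ∃ C : ℝ, 0 < C ∧ ∀ (n m : ℕ) (x : Fin n → ℝ) (b : ℝ), 1 ≤ m → 0 ≤ b → (∀ j, |x j| ≤ b) →
      ((Finset.univ : Finset (Fin n)).filter (fun j => 0 < |x j|)).card ≤ m →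
      lorentzNorm n p u x ≤ C * (b * (m : ℝ) ^ (1 / p.toReal)) := by
  have hP : 0 < p.toReal := ENNReal.toReal_pos hp.ne' hp'
  obtain ⟨C, hC, hnorm⟩ := exists_lorentzNorm_le hp hp' hu (σ := 0) (by positivity)
    (lt_add_one _)
  refine ⟨C, hC, fun n m x b hm hb hx hc => hnorm n m x b hm hb (fun i _ _ _ => ?_)
    fun i _ _ hi => ?_⟩
  · rw [Real.rpow_zero, mul_one]
    exact rearr_le_of_abs_le hb hx i
  · exact (rearr_le le_rfl (hc.trans (by omega))).trans (by positivity)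

/-- Packing bound: a large family of integer vectors cannot be covered by few small balls. -/
lemma exists_le_entropyNumber_of_card (hp : 0 < p) (hq : 0 < q) (hu : 0 < u) (hv : 0 < v)
    (hp' : p ≠ ⊤) (hq' : q ≠ ⊤) {A : ℝ} (hA : WeakCountBound q.toReal A) :
    ∃ c : ℝ, 0 < c ∧ ∀ (n k M : ℕ) (a : ℝ) (G : Finset (Fin n → ℤ)), 1 ≤ M → M ≤ n → 0 < a →
      (∀ z ∈ G, lorentzNorm n p u (fun j => a * (z j : ℝ)) ≤ 1) →
      (2 : ℝ) ^ (k - 1) * (A * n / M) ^ M < G.card →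
      c * (a * (M : ℝ) ^ (1 / q.toReal)) ≤
        entropyNumber n (lorentzNorm n p u) (lorentzNorm n q v) k := by
  have hQ : 0 < q.toReal := ENNReal.toReal_pos hq.ne' hq'
  set Q := q.toReal with hQdef
  have hA0 : 0 < A := zero_lt_one.trans_le hA.1
  obtain ⟨K, hK, hcheb⟩ := exists_card_filter_le_of_lorentzNorm_le hq hq' hv
  refine ⟨1 / 2 * (1 / (2 * K)) ^ (1 / Q), by positivity,
    fun n k M a G hM hMn ha hG hcard => ?_⟩
  have hM0 : (0 : ℝ) < M := by exact_mod_cast hM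
  refine le_entropyNumber hp hq hu hv hp' hq' fun ε hε T hT hcov => ?_
  by_contra! hlt
  have hsmall : 2 * K * (2 * ε / a) ^ Q ≤ M := by
    have h1 : 2 * ε / a ≤ (M / (2 * K)) ^ (1 / Q) := by
      rw [div_le_iff₀ ha, div_eq_mul_one_div (M : ℝ), Real.mul_rpow (by positivity)
        (by positivity)]
      linarith
    have h2 : (2 * ε / a) ^ Q ≤ M / (2 * K) := by
      calc _ ≤ ((M / (2 * K)) ^ (1 / Q)) ^ Q := Real.rpow_le_rpow (by positivity) h1 hQ.le
        _ = _ := by rw [← Real.rpow_mul (by positivity), one_div_mul_cancel hQ.ne', Real.rpow_one]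
    rwa [le_div_iff₀' (by positivity)] at h2
  choose! f hfT hf using fun (z : Fin n → ℤ) (hz : z ∈ G) => hcov _ (hG z hz)
  have hpig : T.card * ⌊(A * n / M) ^ M⌋₊ < G.card := by
    have h1 : (T.card : ℝ) ≤ 2 ^ (k - 1) := by exact_mod_cast hT
    have h2 : (⌊(A * n / M) ^ M⌋₊ : ℝ) ≤ (A * n / M) ^ M := Nat.floor_le (by positivity)
    have h3 : ((T.card * ⌊(A * n / M) ^ M⌋₊ : ℕ) : ℝ) < G.card := by
      push_cast
      refine lt_of_le_of_lt ?_ hcard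
      gcongr
    exact_mod_cast h3
  obtain ⟨y, -, hy⟩ := Finset.exists_lt_card_fiber_of_mul_lt_card_of_maps_to hfT hpig
  set F := {z ∈ G | f z = y} with hF
  obtain ⟨z₀, hz₀⟩ : F.Nonempty := Finset.card_pos.1 (by omega)
  have hmem : ∀ z ∈ F, lorentzNorm n q v ((fun j => a * (z j : ℝ)) - y) ≤ ε := by
    intro z hz
    rw [hF, Finset.mem_filter] at hz
    rw [← hz.2]
    exact hf z hz.1
  have hcF : (F.image fun z => z - z₀).card = F.card :=
    Finset.card_image_of_injective _ sub_left_injective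
  have hcount := hA.2.1 n M (F.image fun z => z - z₀) hM hMn (by
    intro d hd s hs
    obtain ⟨z, hz, rfl⟩ := Finset.mem_image.1 hd
    have hs0 : 0 < s := by linarith
    have hsub : (Finset.univ : Finset (Fin n)).filter (fun j => s ≤ |((z - z₀) j : ℝ)|) ⊆
        (Finset.univ : Finset (Fin n)).filter
          (fun j => a * s / 2 ≤ |((fun j => a * (z j : ℝ)) - y) j|) ∪
        (Finset.univ : Finset (Fin n)).filter
          (fun j => a * s / 2 ≤ |((fun j => a * (z₀ j : ℝ)) - y) j|) := by
      intro j hj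
      simp only [Finset.mem_filter, Finset.mem_union, Finset.mem_univ, true_and,
        Pi.sub_apply] at hj ⊢
      by_contra! hcon
      have h1 := mul_le_mul_of_nonneg_left hj ha.le
      have h2 : a * |((z j - z₀ j : ℤ) : ℝ)| ≤
          |a * (z j : ℝ) - y j| + |a * (z₀ j : ℝ) - y j| := by
        calc a * |((z j - z₀ j : ℤ) : ℝ)|
            = |(a * (z j : ℝ) - y j) - (a * (z₀ j : ℝ) - y j)| := by
              rw [← abs_of_pos ha, ← abs_mul, abs_of_pos ha]
              congr 1
              push_cast; ring
          _ ≤ _ := abs_sub _ _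
      linarith [hcon.1, hcon.2]
    have hc := (Finset.card_le_card hsub).trans (Finset.card_union_le _ _)
    have h1 := hcheb n _ ε (a * s / 2) hε.le (by positivity) (hmem z hz)
    have h2 := hcheb n _ ε (a * s / 2) hε.le (by positivity) (hmem z₀ hz₀)
    have h3 : (ε / (a * s / 2)) ^ Q = (2 * ε / a) ^ Q * s ^ (-Q) := by
      rw [Real.rpow_neg hs0.le, ← div_eq_mul_inv, ← Real.div_rpow (by positivity) hs0.le]
      congr 1
      field_simp
    rw [h3] at h1 h2
    have hcR : (((Finset.univ : Finset (Fin n)).filter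
        (fun j => s ≤ |((z - z₀) j : ℝ)|)).card : ℝ) ≤
        2 * K * (2 * ε / a) ^ Q * s ^ (-Q) := by
      refine (Nat.cast_le.2 hc).trans ?_
      push_cast
      linarith
    exact hcR.trans (by gcongr))
  rw [hcF] at hcount
  exact absurd (Nat.le_floor hcount) (not_le.2 hy)

/-- Volumetric lower bound, valid for all `k`. -/
lemma exists_volume_le_entropyNumber (hp : 0 < p) (hq : 0 < q) (hu : 0 < u) (hv : 0 < v)
    (hp' : p ≠ ⊤) (hq' : q ≠ ⊤) :
    ∃ c : ℝ, 0 < c ∧ ∀ n k : ℕ, 0 < n →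
      c * ((n : ℝ) ^ (1 / q.toReal - 1 / p.toReal) / ((2 : ℝ) ^ (k - 1)) ^ (1 / (n : ℝ))) ≤
        entropyNumber n (lorentzNorm n p u) (lorentzNorm n q v) k := by
  obtain ⟨A, hA⟩ := exists_weakCountBound (ENNReal.toReal_pos hq.ne' hq')
  have hA0 : 0 < A := zero_lt_one.trans_le hA.1
  obtain ⟨c, hc, hpack⟩ := exists_le_entropyNumber_of_card hp hq hu hv hp' hq' hA
  obtain ⟨C, hC, hsp⟩ := exists_lorentzNorm_le_of_sparse hp hp' hu
  refine ⟨c / (2 * A * C), by positivity, fun n k hn => ?_⟩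
  have hn0 : (0 : ℝ) < n := by exact_mod_cast hn
  set y : ℝ := ((2 : ℝ) ^ (k - 1)) ^ (1 / (n : ℝ)) with hy
  have hy0 : 0 < y := by positivity
  have hy1 : 1 ≤ y := Real.one_le_rpow (one_le_pow₀ (by norm_num)) (by positivity)
  have hyn : y ^ n = (2 : ℝ) ^ (k - 1) := by
    rw [hy, one_div, Real.rpow_inv_natCast_pow (by positivity) hn.ne']
  set R : ℕ := ⌊A * y⌋₊ + 1 with hR
  have hR1 : A * y < R := by
    rw [hR]; push_cast; exact Nat.lt_floor_add_one _
  have hR0 : (0 : ℝ) < R := by positivity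
  have hR2 : (R : ℝ) ≤ 2 * A * y := by
    have h1 := Nat.floor_le (by positivity : 0 ≤ A * y)
    have h2 : 1 ≤ A * y := one_le_mul_of_one_le_of_one_le hA.1 hy1
    rw [hR]; push_cast; linarith
  have := hpack n k n ((C * (n : ℝ) ^ (1 / p.toReal))⁻¹ / R)
    (Fintype.piFinset fun _ => Finset.Ico (0 : ℤ) R) hn le_rfl (by positivity) (fun z hz => by
      rw [Fintype.mem_piFinset] at hz
      refine (hsp n n _ ((C * (n : ℝ) ^ (1 / p.toReal))⁻¹) hn (by positivity) (fun j => ?_)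
        ((Finset.card_le_univ _).trans (by simp))).trans_eq ?_
      · have hzj := Finset.mem_Ico.1 (hz j)
        have h0 : (0 : ℝ) ≤ z j := by exact_mod_cast hzj.1
        have h1 : (z j : ℝ) ≤ R := by exact_mod_cast hzj.2.le
        rw [abs_of_nonneg (by positivity), div_mul_eq_mul_div, div_le_iff₀ hR0]
        gcongr
      · field_simp) (by
      rw [Fintype.card_piFinset_const, Int.card_Ico, sub_zero, Int.toNat_natCast,
        mul_div_assoc, div_self hn0.ne', mul_one, ← hyn, ← mul_pow, mul_comm y]
      push_cast
      exact pow_lt_pow_left₀ hR1 (by positivity) hn.ne')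
  refine le_trans ?_ this
  rw [Real.rpow_sub hn0]
  calc _ = c * ((C * (n : ℝ) ^ (1 / p.toReal))⁻¹ / (2 * A * y) * (n : ℝ) ^ (1 / q.toReal)) := by
        field_simp
    _ ≤ _ := by gcongr

/-- Lower bound by packing indicator vectors of sets of size `4 * m`. -/
lemma exists_sparse_le_entropyNumber (hp : 0 < p) (hq : 0 < q) (hu : 0 < u) (hv : 0 < v)
    (hp' : p ≠ ⊤) (hq' : q ≠ ⊤) {A : ℝ} (hA : WeakCountBound q.toReal A) :
    ∃ c : ℝ, 0 < c ∧ ∀ n k m : ℕ, 1 ≤ m → 64 * A * m ≤ n →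
      (2 : ℝ) ^ (k - 1) < (A * n / m) ^ m →
      c * (m : ℝ) ^ (1 / q.toReal - 1 / p.toReal) ≤
        entropyNumber n (lorentzNorm n p u) (lorentzNorm n q v) k := by
  have hA0 : 0 < A := zero_lt_one.trans_le hA.1
  obtain ⟨c, hc, hpack⟩ := exists_le_entropyNumber_of_card hp hq hu hv hp' hq' hA
  obtain ⟨C, hC, hsp⟩ := exists_lorentzNorm_le_of_sparse hp hp' hu
  refine ⟨c * (C * 4 ^ (1 / p.toReal))⁻¹, by positivity, fun n k m hm hmn hk => ?_⟩
  have hm0 : (0 : ℝ) < m := by exact_mod_cast hm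
  have h64 : 64 * (m : ℝ) ≤ n := by nlinarith [hA.1]
  have h64n : 64 * m ≤ n := by exact_mod_cast h64
  set a : ℝ := (C * ((4 * m : ℕ) : ℝ) ^ (1 / p.toReal))⁻¹ with ha
  have ha0 : 0 < a := by positivity
  set ι : Finset (Fin n) → Fin n → ℤ := fun S j => if j ∈ S then 1 else 0 with hι
  have hinj : Function.Injective ι := by
    intro S S' h
    ext j
    have := congrFun h j
    by_cases h1 : j ∈ S <;> by_cases h2 : j ∈ S' <;> simp_all
  have hchoose : ((A * n / m) ^ m) ^ 2 ≤ (n.choose (4 * m) : ℝ) := by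
    have h1 := Nat.pow_le_choose (α := ℝ) (4 * m) n
    have h2 : ((4 * m).factorial : ℝ) ≤ ((4 * m : ℕ) : ℝ) ^ (4 * m) := by
      exact_mod_cast Nat.factorial_le_pow _
    have h3 : (n : ℝ) / 2 ≤ ((n + 1 - 4 * m : ℕ) : ℝ) := by
      rw [Nat.cast_sub (by omega)]
      push_cast
      linarith
    calc ((A * n / m) ^ m) ^ 2 = ((A * n / m) ^ 2) ^ m := pow_right_comm _ _ _
      _ ≤ (((n : ℝ) / (8 * m)) ^ 4) ^ m := by
          refine pow_le_pow_left₀ (by positivity) ?_ m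
          rw [show ((n : ℝ) / (8 * m)) ^ 4 = (((n : ℝ) / (8 * m)) ^ 2) ^ 2 by ring]
          refine pow_le_pow_left₀ (by positivity) ?_ 2
          rw [div_pow, div_le_div_iff₀ hm0 (by positivity)]
          have hn0 : (0 : ℝ) ≤ n * m := by positivity
          nlinarith [mul_le_mul_of_nonneg_left hmn hn0]
      _ = ((n : ℝ) / 2 / ((4 * m : ℕ) : ℝ)) ^ (4 * m) := by
          rw [← pow_mul]
          congr 1
          push_cast
          field_simp
          ring
      _ ≤ (((n + 1 - 4 * m : ℕ) : ℝ) / ((4 * m : ℕ) : ℝ)) ^ (4 * m) := by gcongr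
      _ = ((n + 1 - 4 * m : ℕ) : ℝ) ^ (4 * m) / ((4 * m : ℕ) : ℝ) ^ (4 * m) := div_pow _ _ _
      _ ≤ ((n + 1 - 4 * m : ℕ) : ℝ) ^ (4 * m) / ((4 * m).factorial : ℝ) := by gcongr
      _ ≤ _ := h1
  have := hpack n k m a ((Finset.powersetCard (4 * m) Finset.univ).image ι) hm (by omega) ha0
    (fun z hz => by
      obtain ⟨S, hS, rfl⟩ := Finset.mem_image.1 hz
      have hSc := (Finset.mem_powersetCard.1 hS).2
      refine (hsp n (4 * m) _ a (by omega) ha0.le (fun j => ?_) ?_).trans_eq ?_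
      · simp only [hι]
        split_ifs <;> simp [abs_of_pos ha0, ha0.le]
      · rw [← hSc]
        refine Finset.card_le_card fun j hj => ?_
        by_contra hjS
        simp [hι, hjS] at hj
      · rw [ha]; field_simp) (by
      rw [Finset.card_image_of_injective _ hinj, Finset.card_powersetCard, Finset.card_univ,
        Fintype.card_fin]
      refine lt_of_lt_of_le ?_ hchoose
      rw [sq]
      have hpos : 0 < (A * n / m) ^ m := lt_trans (by positivity) hk
      gcongr)
  refine le_trans (le_of_eq ?_) this
  rw [ha, Real.rpow_sub hm0]
  push_cast
  rw [Real.mul_rpow (by norm_num) hm0.le]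
  field_simp

end LowerBounds

section Comparison

variable {p q u v u' v' : ℝ≥0∞}

/-- The entropy numbers do not depend on the secondary indices, up to constants. -/
lemma exists_entropyNumber_le_mul_entropyNumber (hp : 0 < p) (hq : 0 < q) (hu : 0 < u)
    (hv : 0 < v) (hu' : 0 < u') (hv' : 0 < v') (hpq : p ≠ q) (hp' : p ≠ ⊤) (hq' : q ≠ ⊤) :
    ∃ C : ℝ, 0 < C ∧ ∀ n k : ℕ, 0 < n →
      entropyNumber n (lorentzNorm n p u) (lorentzNorm n q v) k ≤
        C * entropyNumber n (lorentzNorm n p u') (lorentzNorm n q v') k := by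
  obtain ⟨A₁, hA₁⟩ := exists_weakCountBound (ENNReal.toReal_pos hp.ne' hp')
  obtain ⟨A₂, hA₂⟩ := exists_weakCountBound (ENNReal.toReal_pos hq.ne' hq')
  set A := max A₁ A₂
  have hAp : WeakCountBound p.toReal A := hA₁.mono (le_max_left _ _)
  have hAq : WeakCountBound q.toReal A := hA₂.mono (le_max_right _ _)
  have hA1 : 1 ≤ A := hAp.1
  have hA0 : 0 < A := zero_lt_one.trans_le hA1
  have hpq' : p.toReal ≠ q.toReal := fun h => hpq ((ENNReal.toReal_eq_toReal_iff' hp' hq').1 h)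
  set α := 1 / q.toReal - 1 / p.toReal with hα
  obtain ⟨c, hc, hlow⟩ := exists_volume_le_entropyNumber hp hq hu' hv' hp' hq'
  obtain ⟨C, hC, hup⟩ := exists_entropyNumber_le_volume hp hq hu hv hp' hq' hAp
  simp only [← hα] at hlow hup
  have hlow' : ∀ n k : ℕ, 0 < n → (2 : ℝ) ^ (k - 1) < A ^ n → c * ((n : ℝ) ^ α / A) ≤
      entropyNumber n (lorentzNorm n p u') (lorentzNorm n q v') k := by
    intro n k hn hk
    refine le_trans ?_ (hlow n k hn)
    have : ((2 : ℝ) ^ (k - 1)) ^ (1 / (n : ℝ)) ≤ A := by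
      calc _ ≤ (A ^ n) ^ (1 / (n : ℝ)) := Real.rpow_le_rpow (by positivity) hk.le (by positivity)
        _ = A := by rw [one_div, Real.pow_rpow_inv_natCast hA0.le hn.ne']
    gcongr
  have hvol : ∀ n k : ℕ, 0 < n → A ^ n ≤ (2 : ℝ) ^ (k - 1) →
      entropyNumber n (lorentzNorm n p u) (lorentzNorm n q v) k ≤
        C / c * entropyNumber n (lorentzNorm n p u') (lorentzNorm n q v') k := by
    intro n k hn hk
    calc _ ≤ C * _ := hup n k hn hk
      _ = C / c * (c * ((n : ℝ) ^ α / ((2 : ℝ) ^ (k - 1)) ^ (1 / (n : ℝ)))) := by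
          field_simp
      _ ≤ _ := by gcongr; exact hlow n k hn
  have hnn : ∀ n k : ℕ, 0 < n →
      0 ≤ entropyNumber n (lorentzNorm n p u') (lorentzNorm n q v') k := fun n k hn =>
    le_trans (by positivity) (hlow n k hn)
  rcases lt_or_gt_of_ne hpq' with h | h
  · have hα0 : α < 0 := by
      have := one_div_lt_one_div_of_lt (ENNReal.toReal_pos hp.ne' hp') h
      linarith
    obtain ⟨C₀, hC₀, hconst⟩ := exists_entropyNumber_le_const (u := u) (v := v)
      hp hq hu hv hp' hq' h
    obtain ⟨C₁, hC₁, hsparse⟩ := exists_entropyNumber_le_sparse hp hq hu hv hp' hq' h hAp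
    obtain ⟨c₁, hc₁, hslow⟩ := exists_sparse_le_entropyNumber hp hq hu' hv' hp' hq' hAq
    simp only [← hα] at hsparse hslow
    have hCs : ∀ n k m : ℕ, 1 ≤ m →
        (m = 1 ∨ (m - 1 ≤ n ∧ (A * n / (m - 1 : ℕ)) ^ (m - 1) ≤ (2 : ℝ) ^ (k - 1))) →
        entropyNumber n (lorentzNorm n p u) (lorentzNorm n q v) k ≤
          max C₀ C₁ * ((m : ℝ) / 2) ^ α := by
      intro n k m hm hcase
      by_cases hm1 : m = 1
      · subst hm1
        calc _ ≤ C₀ := hconst n k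
          _ ≤ max C₀ C₁ := le_max_left _ _
          _ ≤ _ := le_mul_of_one_le_right (by positivity)
            (Real.one_le_rpow_of_pos_of_le_one_of_nonpos (by norm_num) (by norm_num) hα0.le)
      · obtain ⟨hmn, hk⟩ := hcase.resolve_left hm1
        calc _ ≤ C₁ * ((m - 1 : ℕ) : ℝ) ^ α := hsparse n k (m - 1) (by omega) hmn hk
          _ ≤ max C₀ C₁ * ((m : ℝ) / 2) ^ α := by
            have hm2 : (2 : ℝ) ≤ m := by exact_mod_cast (by omega : 2 ≤ m)
            refine mul_le_mul (le_max_right _ _) ?_ (by positivity) (by positivity)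
            refine Real.rpow_le_rpow_of_nonpos (by positivity) ?_ hα0.le
            rw [Nat.cast_sub hm]
            push_cast
            linarith
    refine ⟨max (C / c) (max (max C₀ C₁ * (1 / 2) ^ α / c₁)
      (max C₀ C₁ * (1 / (128 * A)) ^ α * A / c)), by positivity, fun n k hn => ?_⟩
    have hn0 : (0 : ℝ) < n := by exact_mod_cast hn
    have hE := hnn n k hn
    by_cases hex : ∃ m : ℕ, 1 ≤ m ∧ 64 * A * m ≤ n ∧ (2 : ℝ) ^ (k - 1) < (A * n / m) ^ m
    · obtain ⟨hm, hmn, hk⟩ := Nat.find_spec hex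
      have hmin := fun {j : ℕ} => Nat.find_min (H := hex) (m := j)
      set m := Nat.find hex
      have hm0 : (0 : ℝ) < m := by exact_mod_cast hm
      have hle : (m : ℝ) ≤ n := by nlinarith
      have hup1 := hCs n k m hm (by
        by_cases hm1 : m = 1
        · exact Or.inl hm1
        · have hmn' : m ≤ n := by exact_mod_cast hle
          refine Or.inr ⟨by omega, ?_⟩
          by_contra! hcon
          refine hmin (j := m - 1) (by omega) ⟨by omega, le_trans ?_ hmn, hcon⟩
          gcongr
          omega)
      calc _ ≤ _ := hup1
        _ = max C₀ C₁ * (1 / 2) ^ α / c₁ * (c₁ * (m : ℝ) ^ α) := by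
            rw [div_eq_mul_one_div (m : ℝ), Real.mul_rpow hm0.le (by norm_num)]
            field_simp
        _ ≤ max C₀ C₁ * (1 / 2) ^ α / c₁ * _ :=
            mul_le_mul_of_nonneg_left (hslow n k m hm hmn hk) (by positivity)
        _ ≤ _ := by gcongr; exact le_max_of_le_right (le_max_left _ _)
    · push Not at hex
      rcases le_or_gt (A ^ n) ((2 : ℝ) ^ (k - 1)) with hk | hk
      · exact (hvol n k hn hk).trans (by gcongr; exact le_max_left _ _)
      · set m := ⌊(n : ℝ) / (64 * A)⌋₊ + 1 with hm
        have hfl := Nat.floor_le (by positivity : 0 ≤ (n : ℝ) / (64 * A))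
        have hfl2 := Nat.lt_floor_add_one ((n : ℝ) / (64 * A))
        have h64 : 64 * A * (⌊(n : ℝ) / (64 * A)⌋₊ : ℝ) ≤ n := by
          rwa [le_div_iff₀' (by positivity)] at hfl
        have hup1 := hCs n k m (by omega) (by
          rcases Nat.eq_zero_or_pos ⌊(n : ℝ) / (64 * A)⌋₊ with h0 | h0
          · exact Or.inl (by omega)
          · rw [hm, Nat.add_sub_cancel]
            refine Or.inr ⟨?_, hex _ h0 h64⟩
            have : (⌊(n : ℝ) / (64 * A)⌋₊ : ℝ) ≤ n := by
              have := Nat.cast_nonneg (α := ℝ) ⌊(n : ℝ) / (64 * A)⌋₊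
              nlinarith
            exact_mod_cast this)
        calc _ ≤ _ := hup1
          _ ≤ max C₀ C₁ * ((n : ℝ) * (1 / (128 * A))) ^ α := by
              refine mul_le_mul_of_nonneg_left ?_ (by positivity)
              refine Real.rpow_le_rpow_of_nonpos (by positivity) ?_ hα0.le
              rw [hm]
              push_cast
              have : (n : ℝ) * (1 / (128 * A)) = n / (64 * A) / 2 := by
                field_simp
                norm_num
              linarith
          _ = max C₀ C₁ * (1 / (128 * A)) ^ α * A / c * (c * ((n : ℝ) ^ α / A)) := by
              rw [Real.mul_rpow hn0.le (by positivity)]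
              field_simp
          _ ≤ max C₀ C₁ * (1 / (128 * A)) ^ α * A / c * _ :=
              mul_le_mul_of_nonneg_left (hlow' n k hn hk) (by positivity)
          _ ≤ _ := by gcongr; exact le_max_of_le_right (le_max_right _ _)
  · obtain ⟨C₀, hC₀, hrpow⟩ := exists_entropyNumber_le_rpow (u := u) (v := v)
      hp hq hu hv hp' hq' h
    simp only [← hα] at hrpow
    refine ⟨max (C / c) (C₀ * A / c), by positivity, fun n k hn => ?_⟩
    have hE := hnn n k hn
    rcases le_or_gt (A ^ n) ((2 : ℝ) ^ (k - 1)) with hk | hk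
    · exact (hvol n k hn hk).trans (by gcongr; exact le_max_left _ _)
    · calc _ ≤ _ := hrpow n k hn
        _ = C₀ * A / c * (c * ((n : ℝ) ^ α / A)) := by field_simp
        _ ≤ C₀ * A / c * _ := mul_le_mul_of_nonneg_left (hlow' n k hn hk) (by positivity)
        _ ≤ _ := by gcongr; exact le_max_right _ _

end Comparison

/-- Case (0) of the main theorem: for `0 < p ≠ q < ∞` and `0 < u, v ≤ ∞`, the entropy
numbers of `id : ℓ_{p,u}^n → ℓ_{q,v}^n` are equivalent, uniformly in `k` and `n`, to
those of `id : ℓ_p^n → ℓ_q^n` (note `‖·‖_p = ‖·‖_{p,p}`). -/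
theorem entropy_lorentz_eq_lebesgue
    (p q u v : ℝ≥0∞) (hp : 0 < p) (hq : 0 < q) (hu : 0 < u) (hv : 0 < v)
    (hpq : p ≠ q) (hp' : p ≠ ⊤) (hq' : q ≠ ⊤) :
    ∃ c C : ℝ, 0 < c ∧ 0 < C ∧ ∀ n k : ℕ, 0 < n → 0 < k →
      c * entropyNumber n (lorentzNorm n p p) (lorentzNorm n q q) k ≤
          entropyNumber n (lorentzNorm n p u) (lorentzNorm n q v) k ∧
        entropyNumber n (lorentzNorm n p u) (lorentzNorm n q v) k ≤
          C * entropyNumber n (lorentzNorm n p p) (lorentzNorm n q q) k := by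
  obtain ⟨C₁, hC₁, h₁⟩ :=
    exists_entropyNumber_le_mul_entropyNumber hp hq hp hq hu hv hpq hp' hq'
  obtain ⟨C₂, hC₂, h₂⟩ :=
    exists_entropyNumber_le_mul_entropyNumber hp hq hu hv hp hq hpq hp' hq'
  refine ⟨C₁⁻¹, C₂, by positivity, hC₂, fun n k hn _ => ⟨?_, h₂ n k hn⟩⟩
  rw [inv_mul_le_iff₀ hC₁]
  exact h₁ n k hn
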